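/- arXiv:1207.0775 — 2 statements merged into one kernel-verified Lean document; each statement's English description precedes it below -/
import Mathlib

section
/- Let H : ℝ^n → ℝ^m be a differentiable quasi-convex function. If every critical Pareto point of H is a weak Pareto optimal point of H, then H is pseudo-convex. -/
noncomputable section

/-- `ℝ^n` as a Euclidean space. -/
abbrev E (n : ℕ) := EuclideanSpace ℝ (Fin n)

/-- A vector function `H : ℝ^n → ℝ^m` (given by its components) is quasi-convex if
`H((1-t)x + ty) ⪯ max{H(x), H(y)}` coordinatewise for all `t ∈ [0,1]`. -/
def VecQuasiConvex {n m : ℕ} (h : Fin m → E n → ℝ) : Prop :=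
  ∀ x y : E n, ∀ t ∈ Set.Icc (0 : ℝ) 1, ∀ i,
    h i ((1 - t) • x + t • y) ≤ max (h i x) (h i y)

/-- `x` is a critical Pareto point: no direction `v` has `⟨∇h_i(x), v⟩ < 0` for all `i`. -/
def IsParetoCritical {n m : ℕ} (h : Fin m → E n → ℝ) (x : E n) : Prop :=
  ¬ ∃ v : E n, ∀ i, (inner ℝ (gradient (h i) x) v : ℝ) < 0

/-- `x` is a weak Pareto optimal point: there is no `y` with `H(y) ≺ H(x)`. -/
def IsWeakParetoOpt {n m : ℕ} (h : Fin m → E n → ℝ) (x : E n) : Prop :=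
  ¬ ∃ y : E n, ∀ i, h i y < h i x

/-- A differentiable vector function is pseudo-convex if
`JH(x)(y - x) ⊀ 0` implies `H(y) ⊀ H(x)`. -/
def VecPseudoConvex {n m : ℕ} (h : Fin m → E n → ℝ) : Prop :=
  (∀ i, Differentiable ℝ (h i)) ∧
    ∀ x y : E n, ¬ (∀ i, (inner ℝ (gradient (h i) x) (y - x) : ℝ) < 0) →
      ¬ (∀ i, h i y < h i x)

theorem inner_gradient_sub_nonpos_of_le_on_segment {n : ℕ} {f : E n → ℝ} {x z : E n}
    (hf : DifferentiableAt ℝ f x) (hle : ∀ w ∈ segment ℝ x z, f w ≤ f x) :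
    (inner ℝ (gradient f x) (z - x) : ℝ) ≤ 0 := by
  have hmax : IsLocalMaxOn f (segment ℝ x z) x :=
    Filter.eventually_of_mem self_mem_nhdsWithin hle
  simpa using hmax.hasFDerivWithinAt_nonpos hf.hasGradientAt.hasFDerivAt.hasFDerivWithinAt
    (sub_mem_posTangentConeAt_of_segment_subset subset_rfl)

theorem VecQuasiConvex.le_on_segment {n m : ℕ} {h : Fin m → E n → ℝ} (hqc : VecQuasiConvex h)
    {i : Fin m} {x z : E n} (hzx : h i z ≤ h i x) : ∀ w ∈ segment ℝ x z, h i w ≤ h i x := by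
  intro w hw
  rw [segment_eq_image] at hw
  obtain ⟨t, ht, rfl⟩ := hw
  exact (hqc x z t ht i).trans (max_le le_rfl hzx)

theorem stmt_15 {n m : ℕ} (h : Fin m → E n → ℝ)
    (hdiff : ∀ i, Differentiable ℝ (h i))
    (hqc : VecQuasiConvex h)
    (hcw : ∀ x : E n, IsParetoCritical h x → IsWeakParetoOpt h x) :
    VecPseudoConvex h := by
  refine ⟨hdiff, fun x y hnot hlt => hnot fun i => ?_⟩
  obtain ⟨v, hv⟩ := not_not.mp fun hc => hcw x hc ⟨y, hlt⟩
  have hcont : ContinuousAt (fun ε : ℝ => h i (y - ε • v)) 0 :=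
    ((hdiff i).continuous.comp (by fun_prop)).continuousAt
  have hnear : ∀ᶠ ε in nhdsWithin (0 : ℝ) (Set.Ioi 0), h i (y - ε • v) < h i x :=
    nhdsWithin_le_nhds (hcont.eventually_lt_const (by simpa using hlt i))
  obtain ⟨ε, hε, hεpos⟩ := (hnear.and self_mem_nhdsWithin).exists
  have hnonpos := inner_gradient_sub_nonpos_of_le_on_segment (hdiff i x)
    (hqc.le_on_segment hε.le)
  rw [sub_right_comm, inner_sub_right, inner_smul_right] at hnonpos
  linarith [mul_neg_of_pos_of_neg hεpos (hv i)]
end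
end

section
/- Let H : ℝ^n → ℝ^m be a pseudo-convex function. Then x ∈ ℝ^n is a critical Pareto point of H if and only if x is a weak Pareto optimal point of H. -/
noncomputable section

open Filter Topology in
/-- A differentiable function strictly decreases for small steps along a descent direction. -/
theorem eventually_lt_of_inner_gradient_neg {F : Type*} [NormedAddCommGroup F]
    [InnerProductSpace ℝ F] [CompleteSpace F] {f : F → ℝ} {x v : F}
    (hf : DifferentiableAt ℝ f x) (hv : (inner ℝ (gradient f x) v : ℝ) < 0) :
    ∀ᶠ t : ℝ in 𝓝[>] 0, f (x + t • v) < f x := by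
  have hd : HasDerivAt (fun t : ℝ => f (x + t • v)) (inner ℝ (gradient f x) v) 0 := by
    have := hf.hasGradientAt.hasFDerivAt.hasLineDerivAt v
    simpa [HasLineDerivAt] using this
  have hs := (hasDerivAt_iff_tendsto_slope.mp hd).eventually (gt_mem_nhds hv)
  have hs' := hs.filter_mono (nhdsWithin_mono (0 : ℝ) fun t (ht : 0 < t) => ht.ne')
  filter_upwards [hs', self_mem_nhdsWithin] with t hlt ht
  have ht : 0 < t := ht
  rw [slope_def_field, div_lt_iff₀ (by simpa using ht)] at hlt
  simpa using hlt

theorem stmt_17 {n m : ℕ} (h : Fin m → E n → ℝ)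
    (hpc : VecPseudoConvex h) (x : E n) :
    IsParetoCritical h x ↔ IsWeakParetoOpt h x := by
  refine not_congr ⟨?_, ?_⟩
  · rintro ⟨v, hv⟩
    have hev := Filter.eventually_all.mpr fun i =>
      eventually_lt_of_inner_gradient_neg (hpc.1 i x) (hv i)
    obtain ⟨t, ht⟩ := hev.exists
    exact ⟨x + t • v, ht⟩
  · rintro ⟨y, hy⟩
    exact ⟨y - x, not_imp_not.mp (hpc.2 x y) hy⟩
end
end
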